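/- arXiv:1401.7731 — 4 statements merged into one kernel-verified Lean document; each statement's English description precedes it below -/
import Mathlib

section
/- Let ℏ > 0, let S : ℝ^m × ℝ^K → ℝ have partial derivatives in each new variable y_j everywhere, let M : ℝ^K → ℂ be differentiable, and let ψ : ℝ^m → ℂ be a function with ψ(x₀) ≠ 0 for some x₀ ∈ ℝ^m. Define Φ(x,y) = M(y) · exp(i S(x,y)/ℏ) · ψ(x). If for every j ∈ {1,…,K} and every (x,y) one has −iℏ ∂Φ/∂y_j (x,y) = (∂S/∂y_j)(x,y) · Φ(x,y), then all partial derivatives ∂M/∂y_j vanish identically on ℝ^K, and hence M is a constant function. -/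
/-- The product rule for a wave factor `μ · exp(iσ/ℏ) · c`: if `σ' · μ exp(iσ/ℏ) c` equals `-iℏ` times
the derivative of that factor, then the derivative of the amplitude `μ` vanishes. -/
theorem amplitude_deriv_eq_zero {ℏ : ℝ} (hℏ : ℏ ≠ 0) {μ : ℝ → ℂ} {σ : ℝ → ℝ} {c μ' : ℂ} {σ' s : ℝ}
    (hc : c ≠ 0) (hμ : HasDerivAt μ μ' s) (hσ : HasDerivAt σ σ' s)
    (hcon : ∀ D : ℂ,
      HasDerivAt (fun t => μ t * Complex.exp (Complex.I * (σ t : ℂ) / (ℏ : ℂ)) * c) D s →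
      (-Complex.I * (ℏ : ℂ)) * D =
        (σ' : ℂ) * (μ s * Complex.exp (Complex.I * (σ s : ℂ) / (ℏ : ℂ)) * c)) :
    μ' = 0 := by
  have hℏ' : (ℏ : ℂ) ≠ 0 := by exact_mod_cast hℏ
  have h := hcon _ ((hμ.mul ((hσ.ofReal_comp.const_mul Complex.I).div_const (ℏ : ℂ)).cexp).mul_const c)
  have he := Complex.exp_ne_zero (Complex.I * (σ s : ℂ) / (ℏ : ℂ))
  set e := Complex.exp (Complex.I * (σ s : ℂ) / (ℏ : ℂ))
  have hcancel : (ℏ : ℂ) * (Complex.I * (σ' : ℂ) / (ℏ : ℂ)) = Complex.I * σ' :=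
    mul_div_cancel₀ _ hℏ'
  have hprod : (Complex.I * ℏ * e * c) * μ' = 0 := by
    linear_combination -h - Complex.I * μ s * e * c * hcancel - μ s * e * c * σ' * Complex.I_sq
  exact (mul_eq_zero.mp hprod).resolve_left
    (mul_ne_zero (mul_ne_zero (mul_ne_zero Complex.I_ne_zero hℏ') he) hc)


/-- If the type-I updated state `Φ(x,y) = M(y) · exp(i S(x,y)/ℏ) · ψ(x)`
(with `ψ` not identically zero and `M` differentiable) satisfies all the new post-constraints
`−iℏ ∂Φ/∂y_j = (∂S/∂y_j) · Φ`, then all partial derivatives of the measure factor `M`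
vanish identically, and hence `M` is a constant function. -/
theorem typeI_measure_factor_is_constant
    (ℏ : ℝ) (hℏ : 0 < ℏ) (m K : ℕ)
    (S : ((Fin m → ℝ) × (Fin K → ℝ)) → ℝ)
    (dS : Fin K → (Fin m → ℝ) → (Fin K → ℝ) → ℝ)
    (hS : ∀ (j : Fin K) (x : Fin m → ℝ) (y : Fin K → ℝ),
      HasDerivAt (fun t => S (x, Function.update y j t)) (dS j x y) (y j))
    (M : (Fin K → ℝ) → ℂ) (hM : Differentiable ℝ M)
    (ψ : (Fin m → ℝ) → ℂ) (x₀ : Fin m → ℝ) (hψ : ψ x₀ ≠ 0)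
    (Φ : ((Fin m → ℝ) × (Fin K → ℝ)) → ℂ)
    (hΦ : ∀ x y, Φ (x, y) =
      M y * Complex.exp (Complex.I * (S (x, y) : ℂ) / (ℏ : ℂ)) * ψ x)
    (hcon : ∀ (j : Fin K) (x : Fin m → ℝ) (y : Fin K → ℝ) (D : ℂ),
      HasDerivAt (fun t => Φ (x, Function.update y j t)) D (y j) →
      (-Complex.I * (ℏ : ℂ)) * D = ((dS j x y : ℝ) : ℂ) * Φ (x, y)) :
    (∀ (j : Fin K) (y : Fin K → ℝ),
        deriv (fun t => M (Function.update y j t)) (y j) = 0) ∧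
      ∀ y y' : Fin K → ℝ, M y = M y' := by
  have hpartial (j : Fin K) (y : Fin K → ℝ) :
      HasDerivAt (fun t => M (Function.update y j t)) (fderiv ℝ M y (Pi.single j 1)) (y j) := by
    have hM' : HasFDerivAt M (fderiv ℝ M y) (Function.update y j (y j)) := by
      simpa using (hM y).hasFDerivAt
    exact hM'.comp_hasDerivAt (y j) (hasDerivAt_update y j (y j))
  have hzero (j : Fin K) (y : Fin K → ℝ) : fderiv ℝ M y (Pi.single j 1) = 0 := by
    refine amplitude_deriv_eq_zero hℏ.ne' hψ (hpartial j y) (hS j x₀ y) fun D hD => ?_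
    simpa [hΦ] using hcon j x₀ y D (by simpa only [hΦ] using hD)
  refine ⟨fun j y => (hpartial j y).deriv.trans (hzero j y), is_const_of_fderiv_eq_zero hM fun y => ?_⟩
  refine ContinuousLinearMap.coe_injective (LinearMap.pi_ext' fun j => LinearMap.ext_ring ?_)
  simpa using hzero j y
end

section
/- Let ℏ > 0, let m, K be natural numbers, let M ∈ ℂ, let S : ℝ^m × ℝ^K → ℝ be measurable, let φ : ℝ^m → ℂ be bounded and measurable, and let ψ : ℝ^m × ℝ^K → ℂ be Lebesgue integrable. Define ψ_k : ℝ^m → ℂ by ψ_k(x) = ∫_{ℝ^K} conj(M) e^{−i S(x,y)/ℏ} ψ(x,y) dy (defined for almost every x). Then ∫_{ℝ^m × ℝ^K} conj(ψ(x,y)) · M e^{i S(x,y)/ℏ} φ(x) d(x,y) = ∫_{ℝ^m} conj(ψ_k(x)) · φ(x) dx. That is, the physical inner product of a type-I updated state with a kinematical state at the later step equals the physical inner product of the original state with the correspondingly time-reversed kinematical state, so the type-I physical state updating map preserves the physical inner product. -/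
open MeasureTheory

/-- Unitarity mechanism of the type-I physical state updating map:
pairing the type-I updated state `(x,y) ↦ M e^{iS(x,y)/ℏ} φ(x)` with an integrable
state `ψ` at the later step equals pairing `φ` with the time-reversed state
`ψ_k(x) = ∫ conj(M) e^{−iS(x,y)/ℏ} ψ(x,y) dy` at the earlier step. -/
theorem typeI_updating_preserves_inner_product
    (ℏ : ℝ) (hℏ : 0 < ℏ) (m K : ℕ) (M : ℂ)
    (S : ((Fin m → ℝ) × (Fin K → ℝ)) → ℝ) (hS : Measurable S)
    (φ : (Fin m → ℝ) → ℂ) (hφm : Measurable φ) (C : ℝ) (hφb : ∀ x, ‖φ x‖ ≤ C)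
    (ψ : ((Fin m → ℝ) × (Fin K → ℝ)) → ℂ) (hψ : Integrable ψ) :
    (∫ p : (Fin m → ℝ) × (Fin K → ℝ),
        (starRingEnd ℂ) (ψ p) *
          (M * Complex.exp (Complex.I * (S p : ℂ) / (ℏ : ℂ)) * φ p.1))
      = ∫ x : Fin m → ℝ,
          (starRingEnd ℂ) (∫ y : Fin K → ℝ,
            (starRingEnd ℂ) M * Complex.exp (-(Complex.I * (S (x, y) : ℂ) / (ℏ : ℂ))) *
              ψ (x, y)) * φ x := by
  have hphase : ∀ p, ‖M * Complex.exp (Complex.I * (S p : ℂ) / (ℏ : ℂ)) * φ p.1‖ ≤ ‖M‖ * C := by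
    intro p
    have h : Complex.I * (S p : ℂ) / (ℏ : ℂ) = ((S p / ℏ : ℝ) : ℂ) * Complex.I := by
      push_cast
      ring
    rw [h, norm_mul, norm_mul, Complex.norm_exp_ofReal_mul_I, mul_one]
    exact mul_le_mul_of_nonneg_left (hφb p.1) (norm_nonneg M)
  have hconj : Integrable (fun p => (starRingEnd ℂ) (ψ p)) :=
    Complex.conjCLE.toContinuousLinearMap.integrable_comp hψ
  have hint : Integrable (fun p : (Fin m → ℝ) × (Fin K → ℝ) => (starRingEnd ℂ) (ψ p) *
      (M * Complex.exp (Complex.I * (S p : ℂ) / (ℏ : ℂ)) * φ p.1)) := by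
    refine hconj.mul_bdd (c := ‖M‖ * C) ?_ (Filter.Eventually.of_forall hphase)
    exact Measurable.aestronglyMeasurable (by fun_prop)
  rw [Measure.volume_eq_prod] at hint ⊢
  rw [integral_prod _ hint]
  refine integral_congr_ae (Filter.Eventually.of_forall fun x => ?_)
  simp only
  rw [← integral_conj, ← integral_mul_const]
  refine integral_congr_ae (Filter.Eventually.of_forall fun y => ?_)
  simp only [map_mul, ← Complex.exp_conj, map_neg, map_div₀, Complex.conj_I,
    Complex.conj_ofReal, Complex.conj_conj]
  rw [neg_mul, neg_div, neg_neg]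
  ring
end

section
/- Let ℏ > 0 and define S_Δ : ℝ³ → ℝ by S_Δ(v*, a, b) = ¼((v* − a)² + (v* − b)² + (a − b)²). Then for all (v*, a, b) ∈ ℝ³, ( −iℏ ∂/∂v* + v* − ½(a + b) ) e^{−i S_Δ(v*,a,b)/ℏ} = 0; that is, the new quantum pre-constraint ⁻Ĉ_{v*} = p̂_{v*} + v* − ½(a + b) of the 2–1 Pachner move annihilates the complex conjugate e^{−iS_Δ/ℏ} of the move's updating phase factor. -/
/-- Discrete scalar-field action of an equilateral triangle with vertex field values
`(v*, a, b)`. -/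
noncomputable def SdeltaTri (vs a b : ℝ) : ℝ :=
  (1 / 4) * ((vs - a) ^ 2 + (vs - b) ^ 2 + (a - b) ^ 2)

/-- The derivative of the triangle action in the vertex field value `v*`. -/
theorem hasDerivAt_SdeltaTri (vs a b : ℝ) :
    HasDerivAt (fun t : ℝ => SdeltaTri t a b) (vs - (a + b) / 2) vs := by
  have h := (((((hasDerivAt_id vs).sub_const a).pow 2).add
    (((hasDerivAt_id vs).sub_const b).pow 2)).add_const ((a - b) ^ 2)).const_mul (1 / 4 : ℝ)
  refine h.congr_deriv ?_
  simp only [id]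
  ring

/-- For the 2–1 Pachner move of a scalar field on a 2D triangulation, the new
quantum pre-constraint `⁻Ĉ_{v*} = p̂_{v*} + v* − ½(a+b)` annihilates the complex conjugate
`e^{−iS_Δ/ℏ}` of the move's updating phase factor:
`(−iℏ ∂/∂v* + v* − ½(a+b)) e^{−iS_Δ(v*,a,b)/ℏ} = 0`. -/
theorem pachner21_pre_constraint (ℏ : ℝ) (hℏ : 0 < ℏ) :
    ∀ vs a b : ℝ,
      ∃ D : ℂ,
        HasDerivAt (fun t : ℝ =>
          Complex.exp (-(Complex.I * (SdeltaTri t a b : ℂ) / (ℏ : ℂ)))) D vs ∧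
        (-Complex.I * (ℏ : ℂ)) * D
          + (vs : ℂ) * Complex.exp (-(Complex.I * (SdeltaTri vs a b : ℂ) / (ℏ : ℂ)))
          - (((a : ℂ) + (b : ℂ)) / 2) *
              Complex.exp (-(Complex.I * (SdeltaTri vs a b : ℂ) / (ℏ : ℂ))) = 0 := by
  intro vs a b
  have hℏ' : (ℏ : ℂ) ≠ 0 := Complex.ofReal_ne_zero.mpr hℏ.ne'
  refine ⟨_, ((((hasDerivAt_SdeltaTri vs a b).ofReal_comp.const_mul Complex.I).div_const
    (ℏ : ℂ)).neg).cexp, ?_⟩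
  simp only [Pi.neg_apply]
  push_cast
  field_simp
  rw [Complex.I_sq]
  ring
end

section
/- Let ℏ > 0, let a_1,…,a_m, b : ℝ^m → ℂ be continuous, and let C be the first-order differential operator (C f)(x) = Σ_{j=1}^m a_j(x)(−iℏ ∂f/∂x_j)(x) + b(x) f(x) acting on differentiable functions of the retained variables x ∈ ℝ^m. Let S : ℝ^K × ℝ^m → ℝ be continuously differentiable and let ψ : ℝ^K × ℝ^m → ℂ be continuously differentiable with compact support. Suppose that for every fixed y ∈ ℝ^K, the function x ↦ e^{i S(y,x)/ℏ} ψ(y,x) is annihilated by C. Then the type-II updated state Φ(x) := ∫_{ℝ^K} e^{i S(y,x)/ℏ} ψ(y,x) dy is continuously differentiable and satisfies C Φ = 0. That is, a type-II local move (integrating out the K old variables) preserves every first-order quantum post-constraint in the retained variables that held before the move. -/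
open MeasureTheory

/-- Partial derivative of a function on `ℝ^m` in the `j`-th coordinate direction. -/
noncomputable def pderivCoord' {m : ℕ} {E : Type*} [NormedAddCommGroup E] [NormedSpace ℝ E]
    (f : (Fin m → ℝ) → E) (j : Fin m) (x : Fin m → ℝ) : E :=
  deriv (fun t => f (Function.update x j t)) (x j)

/-- The sections `y ↦ f (y, x)` of a continuous compactly supported function are dominated,
uniformly in `x`, by one integrable function. -/
lemma HasCompactSupport.exists_integrable_bound_fst {E H G : Type*} [TopologicalSpace E]
    [T2Space E] [MeasurableSpace E] [OpensMeasurableSpace E] [TopologicalSpace H]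
    [NormedAddCommGroup G] {μ : Measure E} [IsFiniteMeasureOnCompacts μ]
    {f : E × H → G} (hf : Continuous f) (hc : HasCompactSupport f) :
    ∃ g : E → ℝ, Integrable g μ ∧ ∀ y x, ‖f (y, x)‖ ≤ g y := by
  obtain ⟨C, hC⟩ := hf.bounded_above_of_compact_support hc
  have hK : IsCompact (Prod.fst '' tsupport f) := hc.image continuous_fst
  refine ⟨(Prod.fst '' tsupport f).indicator fun _ => C,
    (integrable_indicator_iff hK.measurableSet).2
      (integrableOn_const hK.measure_lt_top.ne), fun y x => ?_⟩
  by_cases hy : y ∈ Prod.fst '' tsupport f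
  · simpa [hy] using hC (y, x)
  · have h0 : f (y, x) = 0 := image_eq_zero_of_notMem_tsupport fun h => hy ⟨_, h, rfl⟩
    simp [hy, h0]

section ParametricContinuity

variable {E H G : Type*} [NormedAddCommGroup E] [NormedAddCommGroup H] [NormedAddCommGroup G]
  [MeasurableSpace E] [BorelSpace E] [SecondCountableTopology E] {μ : Measure E}
  [IsFiniteMeasureOnCompacts μ]

lemma Continuous.integrable_section_of_hasCompactSupport {f : E × H → G} (hf : Continuous f)
    (hc : HasCompactSupport f) (x : H) : Integrable (fun y => f (y, x)) μ := by
  obtain ⟨g, hg, hfg⟩ := hc.exists_integrable_bound_fst (μ := μ) hf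
  exact hg.mono' (by fun_prop : Continuous fun y => f (y, x)).aestronglyMeasurable
    (.of_forall fun y => hfg y x)

lemma Continuous.integral_section_of_hasCompactSupport [NormedSpace ℝ G] {f : E × H → G}
    (hf : Continuous f) (hc : HasCompactSupport f) : Continuous fun x => ∫ y, f (y, x) ∂μ := by
  obtain ⟨g, hg, hfg⟩ := hc.exists_integrable_bound_fst (μ := μ) hf
  exact continuous_of_dominated
    (fun x => (by fun_prop : Continuous fun y => f (y, x)).aestronglyMeasurable)
    (fun x => .of_forall fun y => hfg y x) hg
    (.of_forall fun y => by fun_prop)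

end ParametricContinuity

section ParametricDerivative

variable {E H G : Type*} [NormedAddCommGroup E] [NormedAddCommGroup H] [NormedAddCommGroup G]
  [NormedSpace ℝ E] [NormedSpace ℝ H] [NormedSpace ℝ G]

/-- The derivative in the second variable. -/
noncomputable def fderivSnd (f : E × H → G) (p : E × H) : H →L[ℝ] G :=
  (fderiv ℝ f p).comp (ContinuousLinearMap.inr ℝ E H)

lemma ContDiff.continuous_fderivSnd {f : E × H → G} (hf : ContDiff ℝ 1 f) :
    Continuous (fderivSnd f) :=
  (hf.continuous_fderiv one_ne_zero).clm_comp continuous_const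

lemma HasCompactSupport.fderivSnd {f : E × H → G} (hc : HasCompactSupport f) :
    HasCompactSupport (fderivSnd f) :=
  (hc.fderiv ℝ).comp_left (g := fun L : E × H →L[ℝ] G =>
    L.comp (ContinuousLinearMap.inr ℝ E H)) (ContinuousLinearMap.zero_comp _)

lemma ContDiff.hasFDerivAt_section {f : E × H → G} (hf : ContDiff ℝ 1 f) (y : E) (x : H) :
    HasFDerivAt (fun z => f (y, z)) (_root_.fderivSnd f (y, x)) x :=
  (hf.differentiable one_ne_zero (y, x)).hasFDerivAt.comp x (hasFDerivAt_prodMk_right y x)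

variable [MeasurableSpace E] [BorelSpace E] [SecondCountableTopology E] {μ : Measure E}
  [IsFiniteMeasureOnCompacts μ]

/-- Differentiation under the integral sign for compactly supported `C¹` functions. -/
lemma ContDiff.hasFDerivAt_integral_section {f : E × H → G} (hf : ContDiff ℝ 1 f)
    (hc : HasCompactSupport f) (x : H) :
    HasFDerivAt (fun z => ∫ y, f (y, z) ∂μ) (∫ y, _root_.fderivSnd f (y, x) ∂μ) x := by
  have hf' := hf.continuous_fderivSnd
  obtain ⟨g, hg, hfg⟩ := hc.fderivSnd.exists_integrable_bound_fst (μ := μ) hf'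
  exact hasFDerivAt_integral_of_dominated_of_fderiv_le (F := fun z y => f (y, z))
    (F' := fun z y => _root_.fderivSnd f (y, z)) Filter.univ_mem
    (.of_forall fun z => (hf.continuous.integrable_section_of_hasCompactSupport hc z).1)
    (hf.continuous.integrable_section_of_hasCompactSupport hc x)
    (hf'.integrable_section_of_hasCompactSupport hc.fderivSnd x).1
    (.of_forall fun y z _ => hfg y z) hg
    (.of_forall fun y z _ => hf.hasFDerivAt_section y z)

lemma ContDiff.integral_section {f : E × H → G} (hf : ContDiff ℝ 1 f)
    (hc : HasCompactSupport f) : ContDiff ℝ 1 fun x => ∫ y, f (y, x) ∂μ :=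
  contDiff_one_iff_hasFDerivAt.2 ⟨_,
    hf.continuous_fderivSnd.integral_section_of_hasCompactSupport hc.fderivSnd,
    hf.hasFDerivAt_integral_section hc⟩

end ParametricDerivative

lemma HasFDerivAt.pderivCoord'_eq {m : ℕ} {E : Type*} [NormedAddCommGroup E] [NormedSpace ℝ E]
    {f : (Fin m → ℝ) → E} {f' : (Fin m → ℝ) →L[ℝ] E} {x : Fin m → ℝ}
    (hf : HasFDerivAt f f' x) (j : Fin m) : pderivCoord' f j x = f' (Pi.single j 1) := by
  have hu : HasDerivAt (Function.update x j) (Pi.single j 1) (x j) := hasDerivAt_update x j (x j)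
  refine HasDerivAt.deriv (HasFDerivAt.comp_hasDerivAt (x j) ?_ hu)
  rwa [Function.update_eq_self]

/-- A type-II local move (integrating out the `K` old variables `y`) preserves
every first-order quantum post-constraint
`(C f)(x) = Σ_j a_j(x)(−iℏ ∂f/∂x_j)(x) + b(x) f(x)` in the retained variables: if for every
fixed `y` the function `x ↦ e^{iS(y,x)/ℏ} ψ(y,x)` is annihilated by `C` (with `a_j`, `b`
continuous, `S` of class `C¹`, `ψ` of class `C¹` with compact support), then the updated
state `Φ(x) = ∫ e^{iS(y,x)/ℏ} ψ(y,x) dy` is `C¹` and satisfies `C Φ = 0`. -/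
theorem typeII_preserves_first_order_post_constraints
    (ℏ : ℝ) (hℏ : 0 < ℏ) (m K : ℕ)
    (a : Fin m → (Fin m → ℝ) → ℂ) (ha : ∀ j, Continuous (a j))
    (b : (Fin m → ℝ) → ℂ) (hb : Continuous b)
    (S : ((Fin K → ℝ) × (Fin m → ℝ)) → ℝ) (hS : ContDiff ℝ 1 S)
    (ψ : ((Fin K → ℝ) × (Fin m → ℝ)) → ℂ) (hψ : ContDiff ℝ 1 ψ)
    (hsupp : HasCompactSupport ψ)
    (hcon : ∀ (y : Fin K → ℝ) (x : Fin m → ℝ),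
      (∑ j, a j x * ((-Complex.I * (ℏ : ℂ)) *
          pderivCoord' (fun z : Fin m → ℝ =>
            Complex.exp (Complex.I * (S (y, z) : ℂ) / (ℏ : ℂ)) * ψ (y, z)) j x))
        + b x * (Complex.exp (Complex.I * (S (y, x) : ℂ) / (ℏ : ℂ)) * ψ (y, x)) = 0) :
    ContDiff ℝ 1 (fun x : Fin m → ℝ =>
        ∫ y : Fin K → ℝ, Complex.exp (Complex.I * (S (y, x) : ℂ) / (ℏ : ℂ)) * ψ (y, x)) ∧
    ∀ x : Fin m → ℝ,
      (∑ j, a j x * ((-Complex.I * (ℏ : ℂ)) *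
          pderivCoord' (fun z : Fin m → ℝ =>
            ∫ y : Fin K → ℝ, Complex.exp (Complex.I * (S (y, z) : ℂ) / (ℏ : ℂ)) * ψ (y, z))
            j x))
        + b x * ∫ y : Fin K → ℝ,
            Complex.exp (Complex.I * (S (y, x) : ℂ) / (ℏ : ℂ)) * ψ (y, x) = 0 := by
  set F : (Fin K → ℝ) × (Fin m → ℝ) → ℂ :=
    fun p => Complex.exp (Complex.I * (S p : ℂ) / (ℏ : ℂ)) * ψ p
  have hFd : ContDiff ℝ 1 F :=
    ((contDiff_const.mul (Complex.ofRealCLM.contDiff.comp hS)).div_const _).cexp.mul hψ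
  have hFc : HasCompactSupport F := hsupp.mul_left
  refine ⟨hFd.integral_section hFc, fun x => ?_⟩
  have hD := hFd.continuous_fderivSnd.integrable_section_of_hasCompactSupport
    (μ := volume) hFc.fderivSnd x
  have hI := hFd.continuous.integrable_section_of_hasCompactSupport (μ := volume) hFc x
  have hcon' : ∀ y, (∑ j, a j x * ((-Complex.I * (ℏ : ℂ)) *
      fderivSnd F (y, x) (Pi.single j 1))) + b x * F (y, x) = 0 := fun y => by
    simpa only [← (hFd.hasFDerivAt_section y x).pderivCoord'_eq] using hcon y x
  have hpd : ∀ j, pderivCoord' (fun z => ∫ y, F (y, z)) j x =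
      ∫ y, fderivSnd F (y, x) (Pi.single j 1) := fun j => by
    rw [(hFd.hasFDerivAt_integral_section hFc x).pderivCoord'_eq,
      ContinuousLinearMap.integral_apply hD]
  change (∑ j, a j x * ((-Complex.I * (ℏ : ℂ)) *
    pderivCoord' (fun z => ∫ y, F (y, z)) j x)) + b x * ∫ y, F (y, x) = 0
  have hDj : ∀ j, Integrable fun y => a j x * ((-Complex.I * (ℏ : ℂ)) *
      fderivSnd F (y, x) (Pi.single j 1)) := fun j =>
    ((hD.apply_continuousLinearMap _).const_mul _).const_mul _
  simp only [hpd, ← integral_const_mul]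
  rw [← integral_finsetSum _ fun j _ => hDj j,
    ← integral_add (integrable_finsetSum _ fun j _ => hDj j) (hI.const_mul _)]
  simp only [hcon', integral_zero]
end
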